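/- Let K be a field with an additive valuation v : K → ℝ∞, let I ⊆ K[x_1,…,x_n] be a weight-homogeneous ideal with respect to weights a_1,…,a_n ∈ ℤ^m, let w ∈ X^an and τ ∈ ℝ^m, and define ν : K[x_1,…,x_n] → ℝ∞ by ν(F) := min_β (w(F̄_β) + β·τ) (minimum over the finitely many β with F_β ≠ 0, ν(0) := ∞, and F̄_β the image of F_β in B). Then: (i) ν(F) = ν(F') whenever F − F' ∈ I, so ν induces a function μ(τ,w) : B → ℝ∞; (ii) μ(τ,w) is an additive valuation on B extending v, i.e. μ(τ,w) ∈ X^an; (iii) μ(τ,w)(x̄_i) = a_i·τ + w(x̄_i) for every i, so trop(μ(τ,w)) = Aτ + trop(w) where (Aτ)_i := a_i·τ; and (iv) the map ℝ^m × X^an → X^an, (τ,w) ↦ μ(τ,w), is continuous. -/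

import Mathlib

open scoped Classical

noncomputable section

/-- `ℝ∞ = ℝ ∪ {∞}`, with the order topology. -/
abbrev RInf := WithTop ℝ

noncomputable instance : TopologicalSpace RInf := Preorder.topology RInf
instance : OrderTopology RInf := ⟨rfl⟩

/-- An additive (non-Archimedean) valuation on a commutative ring, with values in
`ℝ∞`: `w(ab) = w(a) + w(b)`, `w(a+b) ≥ min (w a) (w b)`, `w 1 = 0`, `w 0 = ∞`. -/
structure IsVal {R : Type*} [CommRing R] (w : R → RInf) : Prop where
  map_mul : ∀ a b, w (a * b) = w a + w b
  min_le_add : ∀ a b, min (w a) (w b) ≤ w (a + b)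
  map_one : w 1 = 0
  map_zero : w 0 = ⊤

/-- The analytification of `Spec B`: the set of additive valuations on the `K`-algebra
`B` extending the valuation `v` on `K`, as a subset of the product space `B → ℝ∞`
(topology of pointwise convergence). -/
def An {K : Type*} [Field K] (v : K → RInf) (B : Type*) [CommRing B] [Algebra K B] :
    Set (B → RInf) :=
  {w | IsVal w ∧ ∀ c : K, w (algebraMap K B c) = v c}

variable {K : Type*} [Field K] {ι M : Type*} [Fintype M]

/-- Weight of a monomial exponent `α` with respect to weight vectors `a`. -/
def wt (a : ι → M → ℤ) (α : ι →₀ ℕ) : M → ℤ :=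
  α.sum fun i k => (k : ℤ) • a i

/-- The weight-`β` component `F_β` of a polynomial `F`: the sum of the terms `c·x^α`
of `F` with `Σ_i α_i a_i = β`. -/
def wtComp (a : ι → M → ℤ) (F : MvPolynomial ι K) (β : M → ℤ) : MvPolynomial ι K :=
  ∑ α ∈ F.support.filter (fun α => wt a α = β), MvPolynomial.monomial α (F.coeff α)

/-- An ideal is weight-homogeneous if it contains all weight components of its
members. -/
def WtHomog (a : ι → M → ℤ) (I : Ideal (MvPolynomial ι K)) : Prop :=
  ∀ F ∈ I, ∀ β : M → ℤ, wtComp a F β ∈ I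

/-- Pairing `β·τ` of an integer vector with a real vector. -/
def pairR (β : M → ℤ) (τ : M → ℝ) : ℝ := ∑ j, (β j : ℝ) * τ j

/-- `ν(F) = min_β (w(F̄_β) + β·τ)`: the minimum over the finitely many `β` with
`F_β ≠ 0`, with value `∞` for `F = 0`. -/
def muAux (a : ι → M → ℤ) (I : Ideal (MvPolynomial ι K))
    (w : (MvPolynomial ι K ⧸ I) → RInf) (τ : M → ℝ) (F : MvPolynomial ι K) : RInf :=
  (F.support.image (wt a)).inf fun β =>
    w (Ideal.Quotient.mk I (wtComp a F β)) + ((pairR β τ : ℝ) : RInf)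

/-- `μ(τ,w) : B → ℝ∞`, computed on an arbitrary lift of `f` (for weight-homogeneous
`I` this is independent of the lift). -/
def mu (a : ι → M → ℤ) (I : Ideal (MvPolynomial ι K)) (τ : M → ℝ)
    (w : (MvPolynomial ι K ⧸ I) → RInf) : (MvPolynomial ι K ⧸ I) → RInf :=
  fun f => muAux a I w τ (Function.surjInv Ideal.Quotient.mk_surjective f)

/-- The tropicalisation map `X^an → ℝ∞^ι`, `w ↦ (w(x̄_i))_i`. -/
def tropMap (I : Ideal (MvPolynomial ι K)) (w : (MvPolynomial ι K ⧸ I) → RInf) :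
    ι → RInf :=
  fun i => w (Ideal.Quotient.mk I (MvPolynomial.X i))

/-- `Trop(X)`: the image of the analytification under `trop`, inside `ℝ∞^ι`. -/
def TropSet (v : K → RInf) (I : Ideal (MvPolynomial ι K)) : Set (ι → RInf) :=
  {η | ∃ w ∈ An v (MvPolynomial ι K ⧸ I), tropMap I w = η}

/-- `Trop(X⁰)`: the points of `Trop(X)` with all coordinates finite, inside `ℝ^ι`. -/
def TropSet0 (v : K → RInf) (I : Ideal (MvPolynomial ι K)) : Set (ι → ℝ) :=
  {ξ | ∃ w ∈ An v (MvPolynomial ι K ⧸ I), ∀ i, tropMap I w i = ((ξ i : ℝ) : RInf)}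

end

section RInfTopology

theorem RInf.continuous_coe : Continuous ((↑) : ℝ → RInf) := by
  refine OrderTopology.continuous_iff.2 fun c => ?_
  induction c using WithTop.recTopCoe with
  | top => constructor <;> simp [Set.preimage]
  | coe c =>
    have h₁ : ((↑) : ℝ → RInf) ⁻¹' Set.Ioi (c : RInf) = Set.Ioi c := by ext; simp
    have h₂ : ((↑) : ℝ → RInf) ⁻¹' Set.Iio (c : RInf) = Set.Iio c := by ext; simp
    rw [h₁, h₂]
    exact ⟨isOpen_Ioi, isOpen_Iio⟩

theorem RInf.continuous_add_coe : Continuous fun p : RInf × ℝ => p.1 + (p.2 : RInf) := by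
  refine OrderTopology.continuous_iff.2 fun c => ?_
  induction c using WithTop.recTopCoe with
  | top =>
    have h : (fun p : RInf × ℝ => p.1 + (p.2 : RInf)) ⁻¹' Set.Iio ⊤ = {p | p.1 < ⊤} := by
      ext p; simp [lt_top_iff_ne_top]
    rw [h]
    exact ⟨by simp, isOpen_lt continuous_fst continuous_const⟩
  | coe c =>
    have hc : Continuous fun p : RInf × ℝ => ((c - p.2 : ℝ) : RInf) :=
      RInf.continuous_coe.comp (by fun_prop)
    have h₁ : (fun p : RInf × ℝ => p.1 + (p.2 : RInf)) ⁻¹' Set.Ioi (c : RInf) =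
        {p | ((c - p.2 : ℝ) : RInf) < p.1} := by
      ext ⟨x, r⟩
      induction x using WithTop.recTopCoe with
      | top => simp [-WithTop.LinearOrderedAddCommGroup.coe_sub]
      | coe x =>
        simp [← WithTop.coe_add, -WithTop.LinearOrderedAddCommGroup.coe_sub, sub_lt_iff_lt_add]
    have h₂ : (fun p : RInf × ℝ => p.1 + (p.2 : RInf)) ⁻¹' Set.Iio (c : RInf) =
        {p | p.1 < ((c - p.2 : ℝ) : RInf)} := by
      ext ⟨x, r⟩
      induction x using WithTop.recTopCoe with
      | top => simp
      | coe x =>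
        simp [← WithTop.coe_add, -WithTop.LinearOrderedAddCommGroup.coe_sub, lt_sub_iff_add_lt]
    rw [h₁, h₂]
    exact ⟨isOpen_lt hc continuous_fst, isOpen_lt continuous_fst hc⟩

end RInfTopology

namespace IsVal

variable {R : Type*} [CommRing R] {w : R → RInf}

theorem map_neg (hw : IsVal w) (x : R) : w (-x) = w x := by
  have h : w (-1) = 0 := by
    have h₁ : w (-1) + w (-1) = 0 := by rw [← hw.map_mul, neg_mul_neg, one_mul, hw.map_one]
    generalize w (-1) = y at h₁ ⊢
    induction y using WithTop.recTopCoe with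
    | top => simp at h₁
    | coe y =>
      norm_cast at h₁ ⊢
      linarith
  rw [← neg_one_mul, hw.map_mul, h, zero_add]

theorem map_add_eq_of_lt (hw : IsVal w) {x y : R} (h : w x < w y) : w (x + y) = w x := by
  refine le_antisymm ?_ (by simpa [h.le] using hw.min_le_add x y)
  have := hw.min_le_add (x + y) (-y)
  rw [hw.map_neg, add_neg_cancel_right, min_le_iff] at this
  exact this.resolve_right h.not_ge

theorem min_add_le (hw : IsVal w) (x y : R) (r : RInf) :
    min (w x + r) (w y + r) ≤ w (x + y) + r := by
  rw [min_add_add_right]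
  gcongr
  exact hw.min_le_add x y

theorem le_map_sum_add (hw : IsVal w) {κ : Type*} {s : Finset κ} {f : κ → R} {t r : RInf}
    (h : ∀ i ∈ s, t ≤ w (f i) + r) : t ≤ w (∑ i ∈ s, f i) + r := by
  induction s using Finset.induction_on with
  | empty => simp [hw.map_zero]
  | insert i s hi ih =>
    rw [Finset.sum_insert hi]
    exact (le_min (h i (by simp)) (ih fun j hj => h j (by simp [hj]))).trans
      (hw.min_add_le _ _ r)

theorem lt_map_sum_add (hw : IsVal w) {κ : Type*} {s : Finset κ} {f : κ → R} {t r : RInf}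
    (ht : t < ⊤) (h : ∀ i ∈ s, t < w (f i) + r) : t < w (∑ i ∈ s, f i) + r := by
  induction s using Finset.induction_on with
  | empty => simpa [hw.map_zero] using ht
  | insert i s hi ih =>
    rw [Finset.sum_insert hi]
    exact (lt_min (h i (by simp)) (ih fun j hj => h j (by simp [hj]))).trans_le
      (hw.min_add_le _ _ r)

end IsVal

section WeightComponents

open MvPolynomial

variable {K : Type*} [Field K] {ι M : Type*} (a : ι → M → ℤ)

theorem wt_eq_weight (α : ι →₀ ℕ) : wt a α = Finsupp.weight a α := by
  simp [wt, Finsupp.weight_apply]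

variable [Fintype M]

theorem wtComp_eq_weightedHomogeneousComponent (F : MvPolynomial ι K) (β : M → ℤ) :
    wtComp a F β = weightedHomogeneousComponent a β F := by
  ext α
  rw [coeff_weightedHomogeneousComponent, wtComp, coeff_sum]
  simp only [coeff_monomial, Finset.sum_ite_eq', Finset.mem_filter, mem_support_iff,
    wt_eq_weight]
  split_ifs <;> simp_all

theorem wtComp_eq_zero {F : MvPolynomial ι K} {β : M → ℤ} (h : β ∉ F.support.image (wt a)) :
    wtComp a F β = 0 := by
  rw [wtComp, Finset.filter_eq_empty_iff.2, Finset.sum_empty]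
  exact fun α hα hβ => h (Finset.mem_image.2 ⟨α, hα, hβ⟩)

theorem sum_wtComp (F : MvPolynomial ι K) :
    ∑ β ∈ F.support.image (wt a), wtComp a F β = F := by
  conv_rhs => rw [F.as_sum]
  exact Finset.sum_fiberwise_of_maps_to (fun α hα => Finset.mem_image_of_mem _ hα) _

theorem wtComp_mul (F G : MvPolynomial ι K) (β : M → ℤ) :
    wtComp a (F * G) β =
      ∑ p ∈ (F.support.image (wt a) ×ˢ G.support.image (wt a)).filter
        (fun p => p.1 + p.2 = β), wtComp a F p.1 * wtComp a G p.2 := by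
  conv_lhs => rw [← sum_wtComp a F, ← sum_wtComp a G]
  rw [Finset.sum_mul_sum, ← Finset.sum_product', wtComp_eq_weightedHomogeneousComponent,
    map_sum, Finset.sum_filter]
  refine Finset.sum_congr rfl fun p _ => ?_
  have h : IsWeightedHomogeneous a (wtComp a F p.1 * wtComp a G p.2) (p.1 + p.2) := by
    simp only [wtComp_eq_weightedHomogeneousComponent]
    exact (weightedHomogeneousComponent_isWeightedHomogeneous _ _).mul
      (weightedHomogeneousComponent_isWeightedHomogeneous _ _)
  split_ifs with hp
  · rw [← hp, h.weightedHomogeneousComponent_same]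
  · exact h.weightedHomogeneousComponent_ne _ (Ne.symm hp)

end WeightComponents

section MuAux

open MvPolynomial

variable {K : Type*} [Field K] {ι M : Type*} [Fintype M] {a : ι → M → ℤ}
  {I : Ideal (MvPolynomial ι K)} {w : (MvPolynomial ι K ⧸ I) → RInf}

theorem pairR_add (β γ : M → ℤ) (τ : M → ℝ) : pairR (β + γ) τ = pairR β τ + pairR γ τ := by
  simp [pairR, add_mul, Finset.sum_add_distrib]

theorem continuous_pairR (β : M → ℤ) : Continuous (pairR β) := by
  unfold pairR
  fun_prop

theorem le_muAux_iff (hw : IsVal w) {τ : M → ℝ} {F : MvPolynomial ι K} {t : RInf} :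
    t ≤ muAux a I w τ F ↔
      ∀ β, t ≤ w (Ideal.Quotient.mk I (wtComp a F β)) + ((pairR β τ : ℝ) : RInf) := by
  rw [muAux, Finset.le_inf_iff]
  refine ⟨fun h β => ?_, fun h β _ => h β⟩
  by_cases hβ : β ∈ F.support.image (wt a)
  · exact h β hβ
  · simp [wtComp_eq_zero a hβ, hw.map_zero]

theorem muAux_le (hw : IsVal w) (τ : M → ℝ) (F : MvPolynomial ι K) (β : M → ℤ) :
    muAux a I w τ F ≤ w (Ideal.Quotient.mk I (wtComp a F β)) + ((pairR β τ : ℝ) : RInf) :=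
  (le_muAux_iff hw).1 le_rfl β

theorem muAux_congr (hI : WtHomog a I) (hw : IsVal w) (τ : M → ℝ) {F F' : MvPolynomial ι K}
    (h : F - F' ∈ I) : muAux a I w τ F = muAux a I w τ F' := by
  refine eq_of_forall_le_iff fun t => ?_
  rw [le_muAux_iff hw, le_muAux_iff hw]
  refine forall_congr' fun β => ?_
  rw [(Ideal.Quotient.eq (I := I) (x := wtComp a F β) (y := wtComp a F' β)).2]
  have := hI _ h β
  rwa [wtComp_eq_weightedHomogeneousComponent, map_sub,
    ← wtComp_eq_weightedHomogeneousComponent, ← wtComp_eq_weightedHomogeneousComponent] at this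

theorem mu_mk (hI : WtHomog a I) (hw : IsVal w) (τ : M → ℝ) (F : MvPolynomial ι K) :
    mu a I τ w (Ideal.Quotient.mk I F) = muAux a I w τ F :=
  muAux_congr hI hw τ (Ideal.Quotient.eq.1 (Function.surjInv_eq _ _))

theorem muAux_of_isWeightedHomogeneous (hw : IsVal w) (τ : M → ℝ) {F : MvPolynomial ι K}
    {β : M → ℤ} (hF : IsWeightedHomogeneous a F β) :
    muAux a I w τ F = w (Ideal.Quotient.mk I F) + ((pairR β τ : ℝ) : RInf) := by
  refine eq_of_forall_le_iff fun t => ?_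
  rw [le_muAux_iff hw]
  refine ⟨fun h => ?_, fun h γ => ?_⟩
  · simpa [wtComp_eq_weightedHomogeneousComponent, hF.weightedHomogeneousComponent_same]
      using h β
  · rw [wtComp_eq_weightedHomogeneousComponent]
    by_cases hγ : γ = β
    · rwa [hγ, hF.weightedHomogeneousComponent_same]
    · simp [hF.weightedHomogeneousComponent_ne γ hγ, hw.map_zero]

theorem muAux_C (hw : IsVal w) (τ : M → ℝ) (c : K) :
    muAux a I w τ (C c) = w (Ideal.Quotient.mk I (C c)) := by
  simp [muAux_of_isWeightedHomogeneous hw τ (isWeightedHomogeneous_C a c), pairR]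

theorem min_le_muAux_add (hw : IsVal w) (τ : M → ℝ) (F G : MvPolynomial ι K) :
    min (muAux a I w τ F) (muAux a I w τ G) ≤ muAux a I w τ (F + G) := by
  refine (le_muAux_iff hw).2 fun β => ?_
  have h : wtComp a (F + G) β = wtComp a F β + wtComp a G β := by
    simp [wtComp_eq_weightedHomogeneousComponent]
  rw [h, map_add]
  refine (min_le_min (muAux_le hw τ F β) (muAux_le hw τ G β)).trans ?_
  exact hw.min_add_le _ _ _

theorem map_mk_wtComp_mul (hw : IsVal w) (τ : M → ℝ) (F G : MvPolynomial ι K)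
    (β γ : M → ℤ) :
    w (Ideal.Quotient.mk I (wtComp a F β * wtComp a G γ)) + ((pairR (β + γ) τ : ℝ) : RInf) =
      (w (Ideal.Quotient.mk I (wtComp a F β)) + ((pairR β τ : ℝ) : RInf)) +
        (w (Ideal.Quotient.mk I (wtComp a G γ)) + ((pairR γ τ : ℝ) : RInf)) := by
  rw [map_mul, hw.map_mul, pairR_add, WithTop.coe_add, add_add_add_comm]

theorem add_le_muAux_mul (hw : IsVal w) (τ : M → ℝ) (F G : MvPolynomial ι K) :
    muAux a I w τ F + muAux a I w τ G ≤ muAux a I w τ (F * G) := by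
  refine (le_muAux_iff hw).2 fun β => ?_
  rw [wtComp_mul, map_sum]
  refine hw.le_map_sum_add fun p hp => ?_
  rw [← (Finset.mem_filter.1 hp).2, map_mk_wtComp_mul hw]
  exact add_le_add (muAux_le hw τ F p.1) (muAux_le hw τ G p.2)

theorem exists_mem_eq_muAux {τ : M → ℝ} {F : MvPolynomial ι K} (hF : muAux a I w τ F ≠ ⊤) :
    ∃ β ∈ F.support.image (wt a),
      w (Ideal.Quotient.mk I (wtComp a F β)) + ((pairR β τ : ℝ) : RInf) = muAux a I w τ F := by
  have hne : (F.support.image (wt a)).Nonempty := by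
    rw [Finset.nonempty_iff_ne_empty]
    intro h
    exact hF (by rw [muAux, h, Finset.inf_empty])
  obtain ⟨β, hβ, h⟩ := Finset.exists_mem_eq_inf _ hne fun β =>
    w (Ideal.Quotient.mk I (wtComp a F β)) + ((pairR β τ : ℝ) : RInf)
  exact ⟨β, hβ, h.symm⟩

theorem muAux_mul_le (hw : IsVal w) (τ : M → ℝ) {F G : MvPolynomial ι K}
    (hF : muAux a I w τ F ≠ ⊤) (hG : muAux a I w τ G ≠ ⊤) :
    muAux a I w τ (F * G) ≤ muAux a I w τ F + muAux a I w τ G := by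
  let A (H : MvPolynomial ι K) : Finset (M → ℤ) := (H.support.image (wt a)).filter fun β =>
    w (Ideal.Quotient.mk I (wtComp a H β)) + ((pairR β τ : ℝ) : RInf) = muAux a I w τ H
  have hA {H : MvPolynomial ι K} (hH : muAux a I w τ H ≠ ⊤) : (A H).Nonempty := by
    obtain ⟨β, hβ, h⟩ := exists_mem_eq_muAux hH
    exact ⟨β, Finset.mem_filter.2 ⟨hβ, h⟩⟩
  obtain ⟨β, hβ, γ, hγ, hu⟩ := UniqueSums.uniqueAdd_of_nonempty (hA hF) (hA hG)
  rw [Finset.mem_filter] at hβ hγ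
  have hval := map_mk_wtComp_mul (a := a) hw τ F G β γ
  rw [hβ.2, hγ.2] at hval
  refine (muAux_le hw τ (F * G) (β + γ)).trans (le_of_eq ?_)
  have hmem : (β, γ) ∈ (F.support.image (wt a) ×ˢ G.support.image (wt a)).filter
      (fun p => p.1 + p.2 = β + γ) :=
    Finset.mem_filter.2 ⟨Finset.mem_product.2 ⟨hβ.1, hγ.1⟩, rfl⟩
  rw [wtComp_mul, ← Finset.add_sum_erase _ _ hmem, map_add, hw.map_add_eq_of_lt, hval]
  refine lt_of_add_lt_add_right (a := ((pairR (β + γ) τ : ℝ) : RInf)) ?_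
  rw [hval, map_sum]
  refine hw.lt_map_sum_add (lt_top_iff_ne_top.2 (WithTop.add_ne_top.2 ⟨hF, hG⟩)) fun p hp => ?_
  obtain ⟨hne, hp⟩ := Finset.mem_erase.1 hp
  obtain ⟨hp, hsum⟩ := Finset.mem_filter.1 hp
  obtain ⟨hp₁, hp₂⟩ := Finset.mem_product.1 hp
  rw [← hsum, map_mk_wtComp_mul hw]
  rcases (muAux_le hw τ F p.1).lt_or_eq with h₁ | h₁
  · exact WithTop.add_lt_add_of_lt_of_le hG h₁ (muAux_le hw τ G p.2)
  rcases (muAux_le hw τ G p.2).lt_or_eq with h₂ | h₂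
  · exact WithTop.add_lt_add_of_le_of_lt hF h₁.le h₂
  obtain ⟨h₁, h₂⟩ := hu (Finset.mem_filter.2 ⟨hp₁, h₁.symm⟩) (Finset.mem_filter.2 ⟨hp₂, h₂.symm⟩)
    hsum
  exact absurd (Prod.ext h₁ h₂) hne

theorem muAux_mul (hw : IsVal w) (τ : M → ℝ) (F G : MvPolynomial ι K) :
    muAux a I w τ (F * G) = muAux a I w τ F + muAux a I w τ G := by
  refine le_antisymm ?_ (add_le_muAux_mul hw τ F G)
  by_cases hF : muAux a I w τ F = ⊤
  · simp [hF]
  by_cases hG : muAux a I w τ G = ⊤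
  · simp [hG]
  exact muAux_mul_le hw τ hF hG

theorem isVal_mu (hI : WtHomog a I) (hw : IsVal w) (τ : M → ℝ) : IsVal (mu a I τ w) where
  map_mul x y := by
    obtain ⟨F, rfl⟩ := Ideal.Quotient.mk_surjective x
    obtain ⟨G, rfl⟩ := Ideal.Quotient.mk_surjective y
    rw [← map_mul]
    simp only [mu_mk hI hw, muAux_mul hw]
  min_le_add x y := by
    obtain ⟨F, rfl⟩ := Ideal.Quotient.mk_surjective x
    obtain ⟨G, rfl⟩ := Ideal.Quotient.mk_surjective y
    rw [← map_add]
    simp only [mu_mk hI hw]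
    exact min_le_muAux_add hw τ F G
  map_one := by
    rw [← map_one (Ideal.Quotient.mk I), mu_mk hI hw, ← C_1, muAux_C hw, C_1, map_one,
      hw.map_one]
  map_zero := by
    rw [← map_zero (Ideal.Quotient.mk I), mu_mk hI hw, ← C_0, muAux_C hw, C_0, map_zero,
      hw.map_zero]

theorem mu_mem_An {v : K → RInf} (hI : WtHomog a I) (hw : w ∈ An v (MvPolynomial ι K ⧸ I))
    (τ : M → ℝ) : mu a I τ w ∈ An v (MvPolynomial ι K ⧸ I) := by
  refine ⟨isVal_mu hI hw.1 τ, fun c => ?_⟩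
  rw [← hw.2 c]
  exact (mu_mk hI hw.1 τ (C c)).trans (muAux_C hw.1 τ c)

theorem mu_mk_X (hI : WtHomog a I) (hw : IsVal w) (τ : M → ℝ) (i : ι) :
    mu a I τ w (Ideal.Quotient.mk I (X i)) =
      ((pairR (a i) τ : ℝ) : RInf) + w (Ideal.Quotient.mk I (X i)) := by
  rw [mu_mk hI hw, muAux_of_isWeightedHomogeneous hw τ (isWeightedHomogeneous_X K a i), add_comm]

variable (a I) in
theorem continuous_mu :
    Continuous fun p : (M → ℝ) × ((MvPolynomial ι K ⧸ I) → RInf) => mu a I p.1 p.2 := by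
  refine continuous_pi fun f => Continuous.finset_inf_apply fun β _ => ?_
  exact RInf.continuous_add_coe.comp (f := fun p : (M → ℝ) × ((MvPolynomial ι K ⧸ I) → RInf) =>
      (p.2 (Ideal.Quotient.mk I (wtComp a (Function.surjInv Ideal.Quotient.mk_surjective f) β)),
        pairR β p.1))
    (((continuous_apply _).comp continuous_snd).prodMk ((continuous_pairR β).comp continuous_fst))

end MuAux

/-- For a weight-homogeneous ideal `I`, `w ∈ X^an` and `τ ∈ ℝ^m`:
(i) `ν(F) = min_β (w(F̄_β)+β·τ)` only depends on `F mod I`, so it induces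
`μ(τ,w) : B → ℝ∞`; (ii) `μ(τ,w) ∈ X^an`; (iii) `μ(τ,w)(x̄_i) = a_i·τ + w(x̄_i)`,
so `trop(μ(τ,w)) = Aτ + trop(w)`; (iv) `(τ,w) ↦ μ(τ,w)` is continuous. -/
theorem mu_well_defined_valuation_continuous
    {K : Type*} [Field K] (v : K → RInf) (hv : IsVal v)
    {n m : ℕ} (a : Fin n → Fin m → ℤ)
    (I : Ideal (MvPolynomial (Fin n) K)) (hI : WtHomog a I) :
    (∀ (w : (MvPolynomial (Fin n) K ⧸ I) → RInf),
      w ∈ An v (MvPolynomial (Fin n) K ⧸ I) → ∀ (τ : Fin m → ℝ),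
      -- (i) well-definedness modulo `I`
      (∀ F F' : MvPolynomial (Fin n) K, F - F' ∈ I →
        muAux a I w τ F = muAux a I w τ F') ∧
      -- the induced function on `B` is computed by `ν` on any lift
      (∀ F : MvPolynomial (Fin n) K,
        mu a I τ w (Ideal.Quotient.mk I F) = muAux a I w τ F) ∧
      -- (ii) `μ(τ,w)` is an additive valuation extending `v`
      mu a I τ w ∈ An v (MvPolynomial (Fin n) K ⧸ I) ∧
      -- (iii) `μ(τ,w)(x̄_i) = a_i·τ + w(x̄_i)`, i.e. `trop(μ(τ,w)) = Aτ + trop(w)`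
      (∀ i : Fin n,
        mu a I τ w (Ideal.Quotient.mk I (MvPolynomial.X i)) =
          ((pairR (a i) τ : ℝ) : RInf) +
            w (Ideal.Quotient.mk I (MvPolynomial.X i)))) ∧
    -- (iv) continuity of `(τ, w) ↦ μ(τ,w)`
    Continuous (fun p :
        (Fin m → ℝ) ×
          {w : (MvPolynomial (Fin n) K ⧸ I) → RInf //
            w ∈ An v (MvPolynomial (Fin n) K ⧸ I)} =>
      mu a I p.1 p.2.val) := by
  refine ⟨fun w hw τ => ⟨fun _ _ h => muAux_congr hI hw.1 τ h, mu_mk hI hw.1 τ,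
    mu_mem_An hI hw τ, mu_mk_X hI hw.1 τ⟩, ?_⟩
  exact (continuous_mu a I).comp
    (continuous_fst.prodMk (continuous_subtype_val.comp continuous_snd))
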